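/- Let 𝕂 be ℝ or ℂ, let Ω ⊂ 𝕂^d be a convex domain, and fix k ∈ {1,…,d}. Suppose p ∈ Ω, x ∈ ∂Ω, ε > 0, and there is a 𝕂-linear subspace V of 𝕂^d of 𝕂-dimension k with x − p ∈ V and ε‖x − p‖ ≤ dist(p, (p+V) ∩ ∂Ω). Then the curve σ : [0,∞) → Ω defined by σ(t) = x + e^{−t}(p − x) satisfies |t − s| ≤ d_Ω^{(k)}(σ(s), σ(t)) ≤ (1/ε)|t − s| for all s, t ≥ 0; in particular σ is a (1/ε, 0)-quasi-geodesic for d_Ω^{(k)}. -/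

import Mathlib

open Set Metric MeasureTheory
open scoped ENNReal

noncomputable section

/-- `σ` is absolutely continuous on `[a,b]`: it is the integral of an integrable density. -/
def ACOn {E : Type*} [NormedAddCommGroup E] [NormedSpace ℝ E] (σ : ℝ → E) (a b : ℝ) : Prop :=
  ∃ g : ℝ → E, IntervalIntegrable g volume a b ∧
    ∀ t ∈ Set.Icc a b, σ t = σ a + ∫ s in a..t, g s

variable (𝕜 : Type*) [RCLike 𝕜] {d : ℕ}

/-- The distance `δ_Ω^{(k)}(p; v)` from `p` to the boundary of `Ω`, measured as the supremum over
all `k`-dimensional `𝕜`-linear subspaces `V` containing `v` of the distance from `p` to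
`(p + V) ∩ ∂Ω` (with value `∞` when some such affine plane misses the boundary). -/
noncomputable def qhDelta (Ω : Set (EuclideanSpace 𝕜 (Fin d))) (k : ℕ)
    (p v : EuclideanSpace 𝕜 (Fin d)) : ℝ≥0∞ :=
  ⨆ (V : Submodule 𝕜 (EuclideanSpace 𝕜 (Fin d))) (_ : v ∈ V) (_ : Module.finrank 𝕜 V = k),
    EMetric.infEdist p ({q | ∃ w ∈ V, q = p + w} ∩ frontier Ω)

/-- The generalized `k`-quasi-hyperbolic metric `𝔮_Ω^{(k)}(p;v) = ‖v‖ / δ_Ω^{(k)}(p;v)`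
(interpreted as `0` when `δ_Ω^{(k)}(p;v) = ∞`). -/
noncomputable def qhNorm (Ω : Set (EuclideanSpace 𝕜 (Fin d))) (k : ℕ)
    (p v : EuclideanSpace 𝕜 (Fin d)) : ℝ :=
  ‖v‖ / (qhDelta 𝕜 Ω k p v).toReal

/-- The generalized `k`-quasi-hyperbolic distance: the infimum of `∫ 𝔮_Ω^{(k)}(σ; σ')` over
absolutely continuous curves in `Ω` joining the two points. -/
noncomputable def qhDist (Ω : Set (EuclideanSpace 𝕜 (Fin d))) (k : ℕ)
    (p q : EuclideanSpace 𝕜 (Fin d)) : ℝ :=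
  sInf {L : ℝ | ∃ (a b : ℝ) (σ : ℝ → EuclideanSpace 𝕜 (Fin d)), a ≤ b ∧ ACOn σ a b ∧
    (∀ t ∈ Set.Icc a b, σ t ∈ Ω) ∧ σ a = p ∧ σ b = q ∧
    L = ∫ t in a..b, qhNorm 𝕜 Ω k (σ t) (deriv σ t)}

/-- A (unit speed) geodesic segment for a distance function. -/
def IsGeodesicOn {X : Type*} (dist : X → X → ℝ) (γ : ℝ → X) (a b : ℝ) : Prop :=
  ∀ s ∈ Set.Icc a b, ∀ t ∈ Set.Icc a b, dist (γ s) (γ t) = |s - t|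

/-- Gromov hyperbolicity of a distance function, via `δ`-slim geodesic triangles. -/
def GromovHyperbolicDist {X : Type*} (dist : X → X → ℝ) : Prop :=
  ∃ δ : ℝ, 0 ≤ δ ∧
    ∀ (γ₁ γ₂ γ₃ : ℝ → X) (a₁ b₁ a₂ b₂ a₃ b₃ : ℝ),
      IsGeodesicOn dist γ₁ a₁ b₁ → IsGeodesicOn dist γ₂ a₂ b₂ → IsGeodesicOn dist γ₃ a₃ b₃ →
      γ₁ b₁ = γ₂ a₂ → γ₂ b₂ = γ₃ a₃ → γ₃ b₃ = γ₁ a₁ →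
      ∀ s ∈ Set.Icc a₁ b₁, ∃ t, (t ∈ Set.Icc a₂ b₂ ∧ dist (γ₁ s) (γ₂ t) ≤ δ) ∨
        (t ∈ Set.Icc a₃ b₃ ∧ dist (γ₁ s) (γ₃ t) ≤ δ)

/-- `n` is an `(r,δ)`-quasi-normal vector at `x ∈ ∂Ω`: `n` is a unit vector and
`dist(x + rn, ∂Ω) ≥ δ`. -/
def IsQuasiNormal (Ω : Set (EuclideanSpace 𝕜 (Fin d))) (r δ : ℝ)
    (x n : EuclideanSpace 𝕜 (Fin d)) : Prop :=
  ‖n‖ = 1 ∧ δ ≤ Metric.infDist (x + r • n) (frontier Ω)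

/-- `δ_Ω(p;v)`: the distance from `p` to the boundary along the `𝕜`-line through `p` in
direction `v`. -/
noncomputable def lineBdryDist (Ω : Set (EuclideanSpace 𝕜 (Fin d)))
    (p v : EuclideanSpace 𝕜 (Fin d)) : ℝ :=
  Metric.infDist p ({q | ∃ c : 𝕜, q = p + c • v} ∩ frontier Ω)

open Filter Topology

/-- A segment from a point of an open set to a point outside it meets the frontier. -/
lemma IsOpen.exists_mem_segment_mem_frontier {E : Type*} [AddCommGroup E] [Module ℝ E]
    [TopologicalSpace E] [ContinuousAdd E] [ContinuousSMul ℝ E] {s : Set E} (hs : IsOpen s)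
    {a b : E} (ha : a ∈ s) (hb : b ∉ s) : ∃ q ∈ segment ℝ a b, q ∈ frontier s := by
  by_contra! h
  have hsub : segment ℝ a b ⊆ s ∪ (closure s)ᶜ := by
    intro q hq
    by_cases hqs : q ∈ closure s
    · left
      by_contra hq'
      exact h q hq ⟨hqs, by rwa [hs.interior_eq]⟩
    · exact Or.inr hqs
  have := (convex_segment a b).isPreconnected.subset_left_of_subset_union hs
    isClosed_closure.isOpen_compl (disjoint_compl_right.mono_left subset_closure) hsub
    ⟨a, left_mem_segment ℝ a b, ha⟩
  exact hb (this (right_mem_segment ℝ a b))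

/-- A nonzero vector lies in a subspace of any dimension between `1` and the full dimension. -/
lemma exists_submodule_mem_finrank_eq {K E : Type*} [Field K] [AddCommGroup E] [Module K E]
    {v : E} (hv : v ≠ 0) {k : ℕ} (hk : 1 ≤ k) (hkd : k ≤ Module.finrank K E) :
    ∃ V : Submodule K E, v ∈ V ∧ Module.finrank K V = k := by
  suffices h : ∃ u : Fin k → E, LinearIndependent K u ∧ v ∈ Set.range u by
    obtain ⟨u, hu, hvu⟩ := h
    exact ⟨Submodule.span K (Set.range u), Submodule.subset_span hvu, by
      simpa using finrank_span_eq_card hu⟩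
  induction k, hk using Nat.le_induction with
  | base => exact ⟨fun _ => v, LinearIndependent.of_subsingleton 0 hv, 0, rfl⟩
  | succ n hn ih =>
    obtain ⟨u, hu, i, hi⟩ := ih (by omega)
    obtain ⟨w, hw⟩ := exists_linearIndependent_snoc_of_lt_finrank hu (by omega)
    exact ⟨_, hw, i.castSucc, by simpa using hi⟩

lemma ACOn.continuousOn {E : Type*} [NormedAddCommGroup E] [NormedSpace ℝ E] {σ : ℝ → E}
    {a b : ℝ} (h : ACOn σ a b) : ContinuousOn σ (Icc a b) := by
  obtain ⟨g, hg, hσ⟩ := h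
  rcases le_or_gt a b with hab | hab
  · have := intervalIntegral.continuousOn_primitive_interval' hg left_mem_uIcc
    rw [uIcc_of_le hab] at this
    exact (continuousOn_const.add this).congr hσ
  · simp [Icc_eq_empty_of_lt hab]

lemma ae_hasDerivAt_of_eq_integral {E : Type*} [NormedAddCommGroup E] [NormedSpace ℝ E]
    [CompleteSpace E] {σ g : ℝ → E} {a b : ℝ} (hab : a ≤ b)
    (hg : IntervalIntegrable g volume a b)
    (hσ : ∀ t ∈ Icc a b, σ t = σ a + ∫ s in a..t, g s) :
    ∀ᵐ t, t ∈ Ioo a b → HasDerivAt σ (g t) t := by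
  filter_upwards [hg.ae_hasDerivAt_integral] with t ht htab
  have h := (ht (by rw [uIcc_of_le hab]; exact Ioo_subset_Icc_self htab) a left_mem_uIcc).const_add
    (σ a)
  refine h.congr_of_eventuallyEq ?_
  filter_upwards [Icc_mem_nhds htab.1 htab.2] with u hu using hσ u hu

section qhDelta

variable {𝕜}
variable {Ω : Set (EuclideanSpace 𝕜 (Fin d))} {k : ℕ}

lemma le_qhDelta {p v : EuclideanSpace 𝕜 (Fin d)}
    {V : Submodule 𝕜 (EuclideanSpace 𝕜 (Fin d))} (hv : v ∈ V) (hV : Module.finrank 𝕜 V = k) :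
    infEDist p ({q | ∃ w ∈ V, q = p + w} ∩ frontier Ω) ≤ qhDelta 𝕜 Ω k p v :=
  le_iSup_of_le V (le_iSup_of_le hv (le_iSup_of_le hV le_rfl))

/-- Nearby points and directions see almost as large a slice of the complement of `∂Ω`: a
`k`-plane through `v` is moved to a `k`-plane through `v'` by a linear map close to `1`. -/
lemma eventually_lt_qhDelta {p v : EuclideanSpace 𝕜 (Fin d)} (hv : v ≠ 0) {c : ℝ≥0∞}
    (hc : c < qhDelta 𝕜 Ω k p v) :
    ∀ᶠ z : EuclideanSpace 𝕜 (Fin d) × EuclideanSpace 𝕜 (Fin d) in 𝓝 (p, v),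
      c < qhDelta 𝕜 Ω k z.1 z.2 := by
  simp only [qhDelta, lt_iSup_iff] at hc
  obtain ⟨V, hvV, hVk, hc⟩ := hc
  obtain ⟨c₁, hcc₁, hc₁⟩ := ENNReal.lt_iff_exists_nnreal_btwn.1 hc
  obtain ⟨c₂, hc₁₂, hc₂⟩ := ENNReal.lt_iff_exists_nnreal_btwn.1 hc₁
  have hc₁₂ : (c₁ : ℝ) < c₂ := by exact_mod_cast hc₁₂
  have hKc : IsCompact ((fun w => p + w) '' (closedBall 0 (c₂ : ℝ) ∩ (V : Set _))) :=
    ((isCompact_closedBall _ _).inter_right V.closed_of_finiteDimensional).image (by fun_prop)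
  have hdisj : Disjoint ((fun w => p + w) '' (closedBall 0 (c₂ : ℝ) ∩ (V : Set _)))
      (frontier Ω) := by
    rw [Set.disjoint_left]
    rintro _ ⟨w, ⟨hw, hwV⟩, rfl⟩ hfr
    refine absurd hc₂ (not_lt.2 ?_)
    have hmem : p + w ∈ {q | ∃ w ∈ V, q = p + w} ∩ frontier Ω := ⟨⟨w, hwV, rfl⟩, hfr⟩
    refine (infEDist_le_edist_of_mem (x := p) hmem).trans ?_
    rw [edist_nndist]
    norm_cast
    rw [← NNReal.coe_le_coe, coe_nndist]
    simpa using hw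
  obtain ⟨r, hr, hrK⟩ := Metric.exists_pos_forall_lt_edist hKc isClosed_frontier hdisj
  have hvn : 0 < ‖v‖ := norm_pos_iff.2 hv
  have hη : Tendsto (fun z : EuclideanSpace 𝕜 (Fin d) × EuclideanSpace 𝕜 (Fin d) =>
      ‖z.2 - v‖ / ‖v‖) (𝓝 (p, v)) (𝓝 0) := by
    have : Continuous (fun z : EuclideanSpace 𝕜 (Fin d) × EuclideanSpace 𝕜 (Fin d) =>
      ‖z.2 - v‖ / ‖v‖) := by fun_prop
    simpa using this.tendsto (p, v)
  have hp : Tendsto (fun z : EuclideanSpace 𝕜 (Fin d) × EuclideanSpace 𝕜 (Fin d) =>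
      ‖z.1 - p‖) (𝓝 (p, v)) (𝓝 0) := by
    have : Continuous (fun z : EuclideanSpace 𝕜 (Fin d) × EuclideanSpace 𝕜 (Fin d) =>
      ‖z.1 - p‖) := by fun_prop
    simpa using this.tendsto (p, v)
  have h1 := hη.eventually_lt_const (show (0 : ℝ) < 1 by norm_num)
  have h2 := ((hη.const_sub 1).mul_const (c₂ : ℝ)).eventually_const_lt
    (show (c₁ : ℝ) < (1 - 0) * c₂ by simpa using hc₁₂)
  have h3 := (hp.add (hη.mul_const (c₂ : ℝ))).eventually_lt_const
    (show (0 : ℝ) + 0 * c₂ < r by simpa using hr)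
  filter_upwards [h1, h2, h3] with z hz1 hz2 hz3
  set η := ‖z.2 - v‖ / ‖v‖ with hηdef
  let A : EuclideanSpace 𝕜 (Fin d) →ₗ[𝕜] EuclideanSpace 𝕜 (Fin d) :=
    LinearMap.id + LinearMap.smulRight (((‖v‖ ^ 2 : ℝ) : 𝕜)⁻¹ • (innerSL 𝕜 v).toLinearMap) (z.2 - v)
  have hA : ∀ w, A w = w + (((‖v‖ ^ 2 : ℝ) : 𝕜)⁻¹ * inner 𝕜 v w) • (z.2 - v) := fun w => rfl
  have hAv : A v = z.2 := by
    rw [hA, inner_self_eq_norm_sq_to_K]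
    have : ((‖v‖ : ℝ) : 𝕜) ≠ 0 := by exact_mod_cast hvn.ne'
    push_cast
    rw [inv_mul_cancel₀ (pow_ne_zero 2 this)]
    simp
  have hAn : ∀ w, ‖A w - w‖ ≤ η * ‖w‖ := by
    intro w
    rw [hA, add_sub_cancel_left, norm_smul, norm_mul, norm_inv, RCLike.norm_ofReal,
      abs_of_nonneg (by positivity)]
    calc (‖v‖ ^ 2)⁻¹ * ‖inner 𝕜 v w‖ * ‖z.2 - v‖
        ≤ (‖v‖ ^ 2)⁻¹ * (‖v‖ * ‖w‖) * ‖z.2 - v‖ := by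
          gcongr; exact norm_inner_le_norm v w
      _ = η * ‖w‖ := by rw [hηdef]; field_simp
  have hlow : ∀ w, (1 - η) * ‖w‖ ≤ ‖A w‖ := by
    intro w
    have h4 := hAn w
    have h5 := norm_sub_norm_le w (A w)
    rw [norm_sub_rev] at h5
    linarith
  have hinj : Function.Injective A := by
    rw [← LinearMap.ker_eq_bot, LinearMap.ker_eq_bot']
    intro w hw
    have h6 := hlow w
    rw [hw, norm_zero] at h6
    have : ‖w‖ ≤ 0 := by nlinarith [norm_nonneg w]
    exact norm_le_zero_iff.1 this
  have hmem : z.2 ∈ V.map A := ⟨v, hvV, hAv⟩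
  have hrank : Module.finrank 𝕜 (V.map A) = k := by
    rw [← hVk]
    exact (LinearEquiv.finrank_eq (Submodule.equivMapOfInjective A hinj V)).symm
  refine hcc₁.trans_le (le_trans ?_ (le_qhDelta hmem hrank))
  rw [le_infEDist]
  rintro _ ⟨⟨_, ⟨w, hwV, rfl⟩, rfl⟩, hfr⟩
  by_contra! hlt
  rw [edist_nndist] at hlt
  have hlt : ‖A w‖ < c₁ := by
    have : nndist z.1 (z.1 + A w) < c₁ := by exact_mod_cast hlt
    rw [← NNReal.coe_lt_coe, coe_nndist] at this
    simpa using this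
  have hw : ‖w‖ ≤ c₂ := by
    have h7 := hlow w
    by_contra! h8
    have : (1 - η) * c₂ ≤ (1 - η) * ‖w‖ := by
      gcongr
    linarith
  have hfar := hrK (p + w) ⟨w, ⟨by simpa using hw, hwV⟩, rfl⟩ _ hfr
  rw [edist_nndist] at hfar
  have hfar : (r : ℝ) < ‖(p + w) - (z.1 + A w)‖ := by
    have : r < nndist (p + w) (z.1 + A w) := by exact_mod_cast hfar
    rwa [← NNReal.coe_lt_coe, coe_nndist, dist_eq_norm] at this
  have h9 : ‖(p + w) - (z.1 + A w)‖ ≤ ‖z.1 - p‖ + ‖A w - w‖ := by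
    rw [show (p + w) - (z.1 + A w) = -((z.1 - p) + (A w - w)) by abel, norm_neg]
    exact norm_add_le _ _
  have h10 : η * ‖w‖ ≤ η * c₂ := by gcongr
  linarith [hAn w]

/-- The generalized quasi-hyperbolic metric is jointly Borel measurable. -/
lemma measurable_qhNorm [MeasurableSpace (EuclideanSpace 𝕜 (Fin d))]
    [BorelSpace (EuclideanSpace 𝕜 (Fin d))] :
    Measurable fun z : EuclideanSpace 𝕜 (Fin d) × EuclideanSpace 𝕜 (Fin d) =>
      qhNorm 𝕜 Ω k z.1 z.2 := by
  classical
  let D : EuclideanSpace 𝕜 (Fin d) × EuclideanSpace 𝕜 (Fin d) → ℝ≥0∞ :=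
    fun z => if z.2 = 0 then 0 else qhDelta 𝕜 Ω k z.1 z.2
  have hD : LowerSemicontinuous D := by
    rintro ⟨p, v⟩ c hc
    have hv : v ≠ 0 := by
      rintro rfl
      simp [D] at hc
    simp only [D, hv, if_false] at hc
    have hne : ∀ᶠ z : EuclideanSpace 𝕜 (Fin d) × EuclideanSpace 𝕜 (Fin d) in 𝓝 (p, v),
        z.2 ≠ 0 := continuous_snd.continuousAt.eventually_ne hv
    filter_upwards [hne, eventually_lt_qhDelta hv hc] with z hz hcz
    simpa [D, hz] using hcz
  have heq : (fun z : EuclideanSpace 𝕜 (Fin d) × EuclideanSpace 𝕜 (Fin d) =>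
      qhNorm 𝕜 Ω k z.1 z.2) = fun z => ‖z.2‖ / (D z).toReal := by
    funext z
    by_cases hz : z.2 = 0 <;> simp [qhNorm, D, hz]
  rw [heq]
  exact measurable_snd.norm.div hD.measurable.ennreal_toReal

lemma qhNorm_nonneg (p v : EuclideanSpace 𝕜 (Fin d)) : 0 ≤ qhNorm 𝕜 Ω k p v :=
  div_nonneg (norm_nonneg _) ENNReal.toReal_nonneg

/-- A positive lower bound for the distance to `∂Ω` in one `k`-plane bounds `qhNorm` above. -/
lemma qhNorm_le_of_le_qhDelta {p v : EuclideanSpace 𝕜 (Fin d)} {r : ℝ} (hr : 0 < r)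
    (h : ENNReal.ofReal r ≤ qhDelta 𝕜 Ω k p v) : qhNorm 𝕜 Ω k p v ≤ ‖v‖ / r := by
  rw [qhNorm]
  by_cases htop : qhDelta 𝕜 Ω k p v = ⊤
  · rw [htop]
    simp only [ENNReal.toReal_top, div_zero]
    positivity
  · have := (ENNReal.ofReal_le_iff_le_toReal htop).1 h
    gcongr

lemma infEDist_frontier_le_qhDelta (hk1 : 1 ≤ k) (hkd : k ≤ d)
    {p v : EuclideanSpace 𝕜 (Fin d)} (hv : v ≠ 0) :
    infEDist p (frontier Ω) ≤ qhDelta 𝕜 Ω k p v := by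
  obtain ⟨V, hvV, hVk⟩ := exists_submodule_mem_finrank_eq (K := 𝕜) hv hk1 (by simpa using hkd)
  exact (infEDist_anti inter_subset_right).trans (le_qhDelta hvV hVk)

/-- A half-space containing `Ω` bounds the quasi-hyperbolic metric below. -/
lemma abs_div_le_qhNorm (hk1 : 1 ≤ k) (hkd : k ≤ d) (hΩ : IsOpen Ω)
    (f : EuclideanSpace 𝕜 (Fin d) →L[ℝ] ℝ) {c : ℝ} (hf : ∀ y ∈ Ω, f y < c)
    {y : EuclideanSpace 𝕜 (Fin d)} (hy : y ∈ Ω) (v : EuclideanSpace 𝕜 (Fin d)) :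
    |f v| / (c - f y) ≤ qhNorm 𝕜 Ω k y v := by
  by_cases hfv : f v = 0
  · simpa [hfv] using qhNorm_nonneg y v
  have hv : v ≠ 0 := by
    rintro rfl
    simp at hfv
  have hc : 0 < c - f y := sub_pos.2 (hf y hy)
  have habs : 0 < |f v| := abs_pos.2 hfv
  set s := (c - f y) / f v with hs
  have hout : y + s • v ∉ Ω := by
    intro h
    have := hf _ h
    rw [map_add, map_smul, smul_eq_mul, hs, div_mul_cancel₀ _ hfv] at this
    linarith
  obtain ⟨q, hq, hqfr⟩ := hΩ.exists_mem_segment_mem_frontier hy hout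
  rw [segment_eq_image'] at hq
  obtain ⟨θ, ⟨hθ0, hθ1⟩, rfl⟩ := hq
  have hbound : qhDelta 𝕜 Ω k y v ≤ ENNReal.ofReal (|s| * ‖v‖) := by
    refine iSup_le fun V => iSup_le fun hvV => iSup_le fun _ => ?_
    have hmem : y + θ • (y + s • v - y) ∈ {q | ∃ w ∈ V, q = y + w} ∩ frontier Ω := by
      refine ⟨⟨θ • (y + s • v - y), ?_, rfl⟩, hqfr⟩
      rw [add_sub_cancel_left]
      exact V.smul_of_tower_mem θ (V.smul_of_tower_mem s hvV)
    refine (infEDist_le_edist_of_mem (x := y) hmem).trans ?_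
    rw [edist_dist]
    apply ENNReal.ofReal_le_ofReal
    rw [add_sub_cancel_left, dist_self_add_right, norm_smul, norm_smul, Real.norm_eq_abs,
      Real.norm_eq_abs, abs_of_nonneg hθ0]
    exact mul_le_of_le_one_left (by positivity) hθ1
  have hpos : 0 < qhDelta 𝕜 Ω k y v := by
    refine lt_of_lt_of_le ?_ (infEDist_frontier_le_qhDelta hk1 hkd hv)
    rw [infEDist_pos_iff_notMem_closure, isClosed_frontier.closure_eq]
    exact fun h => (hΩ.frontier_eq ▸ h).2 hy
  have hfin : qhDelta 𝕜 Ω k y v ≠ ⊤ := ne_top_of_le_ne_top ENNReal.ofReal_ne_top hbound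
  have hpos' := ENNReal.toReal_pos hpos.ne' hfin
  have hle : (qhDelta 𝕜 Ω k y v).toReal ≤ |s| * ‖v‖ :=
    ENNReal.toReal_le_of_le_ofReal (by positivity) hbound
  rw [qhNorm, div_le_div_iff₀ hc hpos']
  calc |f v| * (qhDelta 𝕜 Ω k y v).toReal ≤ |f v| * (|s| * ‖v‖) := by gcongr
    _ = ‖v‖ * (c - f y) := by
      rw [hs, abs_div, abs_of_pos hc]
      field_simp

/-- Curves in an open set have finite quasi-hyperbolic length. -/
lemma intervalIntegrable_qhNorm (hk1 : 1 ≤ k) (hkd : k ≤ d) (hΩ : IsOpen Ω)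
    {σ : ℝ → EuclideanSpace 𝕜 (Fin d)} {a b : ℝ} (hab : a ≤ b) (hσ : ACOn σ a b)
    (hσΩ : ∀ t ∈ Icc a b, σ t ∈ Ω) :
    IntervalIntegrable (fun t => qhNorm 𝕜 Ω k (σ t) (deriv σ t)) volume a b := by
  borelize (EuclideanSpace 𝕜 (Fin d))
  have hcont := hσ.continuousOn
  obtain ⟨g, hg, hσg⟩ := hσ
  have hdisj : Disjoint (σ '' Icc a b) (frontier Ω) := by
    rw [Set.disjoint_left]
    rintro _ ⟨t, ht, rfl⟩ h
    exact (hΩ.frontier_eq ▸ h).2 (hσΩ t ht)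
  obtain ⟨r, hr, hrK⟩ := Metric.exists_pos_forall_lt_edist (isCompact_Icc.image_of_continuousOn hcont)
    isClosed_frontier hdisj
  have hmeas : AEStronglyMeasurable (fun t => qhNorm 𝕜 Ω k (σ t) (deriv σ t))
      (volume.restrict (uIoc a b)) := by
    rw [uIoc_of_le hab]
    have hσm : AEMeasurable σ (volume.restrict (Ioc a b)) :=
      (hcont.mono Ioc_subset_Icc_self).aemeasurable measurableSet_Ioc
    exact (measurable_qhNorm.comp_aemeasurable
      (hσm.prodMk (measurable_deriv σ).aemeasurable)).aestronglyMeasurable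
  refine (hg.norm.div_const (r : ℝ)).mono_fun hmeas ?_
  rw [uIoc_of_le hab, Filter.EventuallyLE, ← restrict_Ioo_eq_restrict_Ioc,
    ae_restrict_iff' measurableSet_Ioo]
  filter_upwards [ae_hasDerivAt_of_eq_integral hab hg hσg] with t ht htab
  rw [(ht htab).deriv, Real.norm_of_nonneg (qhNorm_nonneg _ _), Real.norm_of_nonneg (by positivity)]
  by_cases h0 : g t = 0
  · simp [h0, qhNorm]
  · refine qhNorm_le_of_le_qhDelta hr ?_
    refine le_trans ?_ (infEDist_frontier_le_qhDelta hk1 hkd h0)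
    rw [ENNReal.ofReal_coe_nnreal, le_infEDist]
    exact fun y hy => (hrK _ (mem_image_of_mem σ (Ioo_subset_Icc_self htab)) y hy).le

/-- In a half-space `{f < c}` containing `Ω`, quasi-hyperbolic length dominates the logarithmic
change of the height `c - f`. -/
lemma abs_log_sub_log_le_integral_qhNorm (hk1 : 1 ≤ k) (hkd : k ≤ d) (hΩ : IsOpen Ω)
    (f : EuclideanSpace 𝕜 (Fin d) →L[ℝ] ℝ) {c : ℝ} (hf : ∀ y ∈ Ω, f y < c)
    {σ : ℝ → EuclideanSpace 𝕜 (Fin d)} {a b : ℝ} (hab : a ≤ b) (hσ : ACOn σ a b)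
    (hσΩ : ∀ t ∈ Icc a b, σ t ∈ Ω) :
    |Real.log (c - f (σ b)) - Real.log (c - f (σ a))| ≤
      ∫ t in a..b, qhNorm 𝕜 Ω k (σ t) (deriv σ t) := by
  have hint := intervalIntegrable_qhNorm hk1 hkd hΩ hab hσ hσΩ
  have hcont := hσ.continuousOn
  obtain ⟨g, hg, hσg⟩ := hσ
  have hhcont : ContinuousOn (fun t => c - f (σ t)) (Icc a b) :=
    continuousOn_const.sub (f.continuous.comp_continuousOn hcont)
  obtain ⟨t₀, ht₀, hmin⟩ := isCompact_Icc.exists_isMinOn (nonempty_Icc.2 hab) hhcont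
  set m := c - f (σ t₀) with hm
  have hm0 : 0 < m := sub_pos.2 (hf _ (hσΩ _ ht₀))
  have hmle : ∀ t ∈ Icc a b, m ≤ c - f (σ t) := fun t ht => hmin ht
  have hfg : IntervalIntegrable (fun t => f (g t)) volume a b :=
    ⟨f.integrable_comp hg.1, f.integrable_comp hg.2⟩
  have hheight : ∀ t ∈ Icc a b, c - f (σ t) = c - f (σ a) - ∫ s in a..t, f (g s) := by
    intro t ht
    rw [hσg t ht, map_add, f.intervalIntegral_comp_comm]
    · ring
    · exact hg.mono_set (by
        rw [uIcc_of_le hab, uIcc_of_le ht.1]; exact Icc_subset_Icc_right ht.2)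
  have hlip : ∀ u ∈ Icc a b, ∀ w ∈ Icc a b,
      dist (Real.log (c - f (σ u))) (Real.log (c - f (σ w))) ≤
        m⁻¹ * dist (∫ s in a..u, f (g s)) (∫ s in a..w, f (g s)) := by
    have hlog : LipschitzOnWith m⁻¹.toNNReal Real.log (Ici m) := by
      refine (convex_Ici m).lipschitzOnWith_of_nnnorm_deriv_le (fun x hx => ?_) (fun x hx => ?_)
      · exact Real.differentiableAt_log (hm0.trans_le hx).ne'
      · rw [← NNReal.coe_le_coe, coe_nnnorm, Real.coe_toNNReal _ (by positivity), Real.deriv_log,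
          norm_inv, Real.norm_of_nonneg (hm0.le.trans hx)]
        exact inv_anti₀ hm0 hx
    intro u hu w hw
    refine (hlog.dist_le_mul _ (hmle u hu) _ (hmle w hw)).trans_eq ?_
    rw [hheight u hu, hheight w hw, dist_sub_left, Real.coe_toNNReal _ (by positivity)]
  have hac : AbsolutelyContinuousOnInterval (fun t => Real.log (c - f (σ t))) a b := by
    have h₀ := hfg.absolutelyContinuousOnInterval_intervalIntegral (c := a) left_mem_uIcc
    rw [absolutelyContinuousOnInterval_iff] at h₀ ⊢
    intro ε hε
    obtain ⟨δ, hδ, h⟩ := h₀ (m * ε) (by positivity)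
    refine ⟨δ, hδ, fun E hE hEδ => ?_⟩
    calc _ ≤ ∑ i ∈ Finset.range E.1, m⁻¹ *
          dist (∫ s in a..(E.2 i).1, f (g s)) (∫ s in a..(E.2 i).2, f (g s)) := by
          refine Finset.sum_le_sum fun i hi => ?_
          have := hE.1 i hi
          rw [uIcc_of_le hab] at this
          exact hlip _ this.1 _ this.2
      _ < m⁻¹ * (m * ε) := by
          rw [← Finset.mul_sum]
          exact mul_lt_mul_of_pos_left (h E hE hEδ) (by positivity)
      _ = ε := by field_simp
  rw [← hac.integral_deriv_eq_sub, ← Real.norm_eq_abs]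
  refine intervalIntegral.norm_integral_le_of_norm_le hab ?_ hint
  have hb : ∀ᵐ t, t ≠ b := by simp [ae_iff, measure_singleton]
  filter_upwards [ae_hasDerivAt_of_eq_integral hab hg hσg, hb] with t ht htb htab
  have htab' : t ∈ Ioo a b := ⟨htab.1, lt_of_le_of_ne htab.2 htb⟩
  have hd := ht htab'
  have hΩt := hσΩ t (Ioo_subset_Icc_self htab')
  have hpos : 0 < c - f (σ t) := sub_pos.2 (hf _ hΩt)
  have hlogd := ((f.hasFDerivAt.comp_hasDerivAt t hd).const_sub c).log hpos.ne'
  have hlogd' : deriv (fun t => Real.log (c - f (σ t))) t = -f (g t) / (c - f (σ t)) := hlogd.deriv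
  rw [hlogd', hd.deriv, norm_div, norm_neg, Real.norm_eq_abs, Real.norm_of_nonneg hpos.le]
  exact abs_div_le_qhNorm hk1 hkd hΩ f hf hΩt (g t)

/-- The quasi-hyperbolic distance is at most the length of any admissible curve. -/
lemma qhDist_le_integral {σ : ℝ → EuclideanSpace 𝕜 (Fin d)} {a b : ℝ} (hab : a ≤ b)
    (hσ : ACOn σ a b) (hσΩ : ∀ t ∈ Icc a b, σ t ∈ Ω) :
    qhDist 𝕜 Ω k (σ a) (σ b) ≤ ∫ t in a..b, qhNorm 𝕜 Ω k (σ t) (deriv σ t) := by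
  refine csInf_le ⟨0, ?_⟩ ⟨a, b, σ, hab, hσ, hσΩ, rfl, rfl, rfl⟩
  rintro _ ⟨a', b', τ, hab', -, -, -, -, rfl⟩
  exact intervalIntegral.integral_nonneg hab' fun _ _ => qhNorm_nonneg _ _

/-- Along the segment from `p` to a boundary point `x`, the distance to `∂Ω` inside the plane
directed by `V` shrinks at most linearly: homotheties centred at `x` map `Ω` into itself. -/
lemma ofReal_le_infEDist_homothety (hΩ : IsOpen Ω) (hconv : Convex ℝ Ω)
    {p x : EuclideanSpace 𝕜 (Fin d)} (hp : p ∈ Ω) (hx : x ∈ closure Ω) {R : ℝ}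
    {V : Submodule 𝕜 (EuclideanSpace 𝕜 (Fin d))}
    (hR : ENNReal.ofReal R ≤ infEDist p ({q | ∃ w ∈ V, q = p + w} ∩ frontier Ω))
    {θ : ℝ} (hθ0 : 0 < θ) (hθ1 : θ ≤ 1) :
    ENNReal.ofReal (θ * R) ≤ infEDist (x + θ • (p - x))
      ({q | ∃ w ∈ V, q = x + θ • (p - x) + w} ∩ frontier Ω) := by
  rw [le_infEDist]
  rintro _ ⟨⟨w, hw, rfl⟩, hfr⟩
  rw [edist_dist, dist_self_add_right]
  apply ENNReal.ofReal_le_ofReal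
  by_contra! hlt
  have hw' : θ⁻¹ • w ∈ V := V.smul_of_tower_mem _ hw
  have hnorm : ‖θ⁻¹ • w‖ < R := by
    rw [norm_smul, norm_inv, Real.norm_of_nonneg hθ0.le]
    rwa [inv_mul_lt_iff₀ hθ0]
  have hq : p + θ⁻¹ • w ∈ Ω := by
    by_contra hout
    obtain ⟨q, hq, hqfr⟩ := hΩ.exists_mem_segment_mem_frontier hp hout
    rw [segment_eq_image'] at hq
    obtain ⟨s, ⟨hs0, hs1⟩, rfl⟩ := hq
    have hmem : p + s • (p + θ⁻¹ • w - p) ∈ {q | ∃ w ∈ V, q = p + w} ∩ frontier Ω := by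
      refine ⟨⟨s • (p + θ⁻¹ • w - p), ?_, rfl⟩, hqfr⟩
      rw [add_sub_cancel_left]
      exact V.smul_of_tower_mem s hw'
    have h := hR.trans (infEDist_le_edist_of_mem (x := p) hmem)
    rw [edist_dist, ENNReal.ofReal_le_ofReal_iff dist_nonneg, add_sub_cancel_left,
      dist_self_add_right, norm_smul, Real.norm_of_nonneg hs0] at h
    nlinarith [norm_nonneg (θ⁻¹ • w)]
  have hin : x + θ • (p - x) + w ∈ Ω := by
    have h := hconv.add_smul_sub_mem_interior' hx (by rwa [hΩ.interior_eq]) ⟨hθ0, hθ1⟩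
    rw [hΩ.interior_eq] at h
    convert h using 1
    rw [show p + θ⁻¹ • w - x = (p - x) + θ⁻¹ • w by abel, smul_add, smul_inv_smul₀ hθ0.ne']
    abel
  exact (hΩ.frontier_eq ▸ hfr).2 hin

end qhDelta

/-- Proposition 7.3: the exponentially reparametrized segment from a boundary
point toward an interior point is a `(1/ε, 0)`-quasi-geodesic for `d_Ω^{(k)}`. -/
theorem stmt_16 {𝕜 : Type*} [RCLike 𝕜] {d : ℕ} (Ω : Set (EuclideanSpace 𝕜 (Fin d)))
    (hΩopen : IsOpen Ω) (hΩne : Ω.Nonempty) (hΩconv : Convex ℝ Ω)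
    (k : ℕ) (hk1 : 1 ≤ k) (hkd : k ≤ d)
    (p : EuclideanSpace 𝕜 (Fin d)) (hp : p ∈ Ω)
    (x : EuclideanSpace 𝕜 (Fin d)) (hx : x ∈ frontier Ω)
    (ε : ℝ) (hε : 0 < ε) (V : Submodule 𝕜 (EuclideanSpace 𝕜 (Fin d)))
    (hV : Module.finrank 𝕜 V = k) (hxp : x - p ∈ V)
    (hdist : ENNReal.ofReal (ε * ‖x - p‖) ≤
      EMetric.infEdist p ({q | ∃ w ∈ V, q = p + w} ∩ frontier Ω)) :
    (∀ t : ℝ, 0 ≤ t → x + Real.exp (-t) • (p - x) ∈ Ω) ∧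
    ∀ s : ℝ, 0 ≤ s → ∀ t : ℝ, 0 ≤ t →
      |t - s| ≤ qhDist 𝕜 Ω k (x + Real.exp (-s) • (p - x)) (x + Real.exp (-t) • (p - x)) ∧
      qhDist 𝕜 Ω k (x + Real.exp (-s) • (p - x)) (x + Real.exp (-t) • (p - x)) ≤
        (1 / ε) * |t - s| := by
  have hxcl : x ∈ closure Ω := frontier_subset_closure hx
  have hxΩ : x ∉ Ω := (hΩopen.frontier_eq ▸ hx).2
  obtain ⟨f, hf⟩ := geometric_hahn_banach_open_point hΩconv hΩopen hxΩ
  have hxp0 : 0 < ‖x - p‖ := norm_pos_iff.2 (sub_ne_zero.2 fun h => hxΩ (h ▸ hp))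
  have hexp : ∀ t : ℝ, 0 ≤ t → Real.exp (-t) ≤ 1 := fun t ht => Real.exp_le_one_iff.2 (by linarith)
  have hmem : ∀ t : ℝ, 0 ≤ t → x + Real.exp (-t) • (p - x) ∈ Ω := by
    intro t ht
    have h := hΩconv.add_smul_sub_mem_interior' hxcl (by rwa [hΩopen.interior_eq])
      ⟨Real.exp_pos (-t), hexp t ht⟩
    rwa [hΩopen.interior_eq] at h
  have hspeed : ∀ t : ℝ, 0 ≤ t → ∀ c : ℝ, |c| = Real.exp (-t) →
      qhNorm 𝕜 Ω k (x + Real.exp (-t) • (p - x)) (c • (p - x)) ≤ 1 / ε := by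
    intro t ht c hc
    have hpxV : c • (p - x) ∈ V := V.smul_of_tower_mem c (by rw [← neg_sub]; exact V.neg_mem hxp)
    have h := (ofReal_le_infEDist_homothety hΩopen hΩconv hp hxcl hdist (Real.exp_pos (-t))
      (hexp t ht)).trans (le_qhDelta hpxV hV)
    refine (qhNorm_le_of_le_qhDelta (by positivity) h).trans_eq ?_
    rw [norm_smul, Real.norm_eq_abs, hc, norm_sub_rev p x]
    field_simp
  have hcurve : ∀ s : ℝ, 0 ≤ s → ∀ t : ℝ, 0 ≤ t →
      ∃ (a b : ℝ) (τ : ℝ → EuclideanSpace 𝕜 (Fin d)), a ≤ b ∧ ACOn τ a b ∧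
        (∀ u ∈ Set.Icc a b, τ u ∈ Ω) ∧ τ a = x + Real.exp (-s) • (p - x) ∧
        τ b = x + Real.exp (-t) • (p - x) ∧
        ∫ u in a..b, qhNorm 𝕜 Ω k (τ u) (deriv τ u) ≤ (1 / ε) * |t - s| := by
    have horiented : ∀ κ : ℝ, |κ| = 1 → ∀ a b : ℝ, a ≤ b → (∀ u ∈ Set.Icc a b, 0 ≤ κ * u) →
        ∃ τ : ℝ → EuclideanSpace 𝕜 (Fin d), ACOn τ a b ∧ (∀ u ∈ Set.Icc a b, τ u ∈ Ω) ∧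
          τ a = x + Real.exp (-(κ * a)) • (p - x) ∧ τ b = x + Real.exp (-(κ * b)) • (p - x) ∧
          ∫ u in a..b, qhNorm 𝕜 Ω k (τ u) (deriv τ u) ≤ (1 / ε) * |b - a| := by
      intro κ hκ a b hab hpos
      have hderiv : ∀ u : ℝ, HasDerivAt (fun u : ℝ => x + Real.exp (-(κ * u)) • (p - x))
          ((Real.exp (-(κ * u)) * -κ) • (p - x)) u := by
        intro u
        have h : HasDerivAt (fun u : ℝ => -(κ * u)) (-κ) u := by
          simpa using ((hasDerivAt_id u).const_mul κ).fun_neg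
        exact (h.exp.smul_const (p - x)).const_add x
      have hcont : Continuous fun u : ℝ => (Real.exp (-(κ * u)) * -κ) • (p - x) := by fun_prop
      refine ⟨fun u => x + Real.exp (-(κ * u)) • (p - x),
        ⟨_, hcont.intervalIntegrable a b, fun t _ => ?_⟩, fun u hu => hmem _ (hpos u hu),
        rfl, rfl, ?_⟩
      · rw [intervalIntegral.integral_eq_sub_of_hasDerivAt (fun u _ => hderiv u)
          (hcont.intervalIntegrable a t)]
        exact (add_sub_cancel _ _).symm
      · refine (Real.le_norm_self _).trans
          (intervalIntegral.norm_integral_le_of_norm_le_const fun u hu => ?_)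
        rw [uIoc_of_le hab] at hu
        rw [Real.norm_of_nonneg (qhNorm_nonneg _ _), (hderiv u).deriv]
        refine hspeed _ (hpos u (Ioc_subset_Icc_self hu)) _ ?_
        rw [abs_mul, abs_neg, hκ, mul_one, abs_of_pos (Real.exp_pos _)]
    intro s hs t ht
    rcases le_total s t with hst | hst
    · obtain ⟨τ, h1, h2, h3, h4, h5⟩ := horiented 1 (by simp) s t hst
        (fun u hu => by linarith [hu.1])
      exact ⟨s, t, τ, hst, h1, h2, by simpa using h3, by simpa using h4, h5⟩
    · obtain ⟨τ, h1, h2, h3, h4, h5⟩ := horiented (-1) (by simp) (-s) (-t) (by linarith)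
        (fun u hu => by linarith [hu.2])
      refine ⟨-s, -t, τ, by linarith, h1, h2, by simpa using h3, by simpa using h4, ?_⟩
      rwa [neg_sub_neg, abs_sub_comm] at h5
  refine ⟨hmem, fun s hs t ht => ?_⟩
  obtain ⟨a, b, τ, hab, hτ, hτΩ, hτa, hτb, hlen⟩ := hcurve s hs t ht
  constructor
  · refine le_csInf ⟨_, a, b, τ, hab, hτ, hτΩ, hτa, hτb, rfl⟩ ?_
    rintro _ ⟨a', b', σ, hab', hσ, hσΩ, hσa, hσb, rfl⟩
    have h := abs_log_sub_log_le_integral_qhNorm hk1 hkd hΩopen f hf hab' hσ hσΩ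
    have hlog : ∀ u : ℝ, Real.log (f x - f (x + Real.exp (-u) • (p - x))) =
        -u + Real.log (f x - f p) := by
      intro u
      rw [map_add, map_smul, map_sub, smul_eq_mul,
        show f x - (f x + Real.exp (-u) * (f p - f x)) = Real.exp (-u) * (f x - f p) by ring,
        Real.log_mul (Real.exp_ne_zero _) (sub_pos.2 (hf p hp)).ne', Real.log_exp]
    rw [hσa, hσb, hlog, hlog, add_sub_add_right_eq_sub, neg_sub_neg, abs_sub_comm] at h
    exact h
  · rw [← hτa, ← hτb]
    exact (qhDist_le_integral hab hτ hτΩ).trans hlen
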